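/- Let c > 0, let Z be a real random variable with E[Z²] < ∞, and let q be a probability density on (0, ∞) such that λ ↦ q(λ) log q(λ), λ ↦ q(λ) log λ, λ ↦ λ q(λ), and λ ↦ q(λ)/λ are integrable. Then 2c · E[max(0, Z)] ≤ ∫₀^∞ q(λ) [ log q(λ) + (1/2) log(2πλ) + E[(λ + cZ)²]/(2λ) ] dλ. (Variational upper bound on the expected hinge loss under a corrupting distribution, with the variational density q chosen independently of the corruption.) -/

import Mathlib

open MeasureTheory Real

open Filter Topology Set

theorem hasDerivAt_integral_exp_neg_half_sq (x : ℝ) :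
    HasDerivAt (fun y => ∫ t in (0 : ℝ)..y, exp (-(1 / 2) * t ^ 2)) (exp (-(1 / 2) * x ^ 2)) x := by
  have hcont : Continuous fun t : ℝ => exp (-(1 / 2) * t ^ 2) := by fun_prop
  exact intervalIntegral.integral_hasDerivAt_right (hcont.intervalIntegrable _ _)
    (hcont.stronglyMeasurableAtFilter _ _) hcont.continuousAt

theorem tendsto_integral_exp_neg_half_sq_atTop :
    Tendsto (fun y => ∫ t in (0 : ℝ)..y, exp (-(1 / 2) * t ^ 2)) atTop (𝓝 (√(2 * π) / 2)) := by
  have h := intervalIntegral_tendsto_integral_Ioi 0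
    (integrable_exp_neg_mul_sq (b := 1 / 2) (by norm_num)).integrableOn tendsto_id
  rw [integral_gaussian_Ioi] at h
  rwa [show π / (1 / 2) = 2 * π by ring] at h

theorem tendsto_integral_exp_neg_half_sq_atBot :
    Tendsto (fun y => ∫ t in (0 : ℝ)..y, exp (-(1 / 2) * t ^ 2)) atBot (𝓝 (-(√(2 * π) / 2))) := by
  refine (tendsto_integral_exp_neg_half_sq_atTop.comp tendsto_neg_atBot_atTop).neg.congr fun y => ?_
  have h := intervalIntegral.integral_comp_neg (a := 0) (b := y) fun t : ℝ => exp (-(1 / 2) * t ^ 2)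
  simp only [neg_sq, neg_zero] at h
  rw [Function.comp_apply, h, intervalIntegral.integral_symm, neg_neg]

/-- The reciprocal inverse Gaussian density, up to its normalizing constant `√(2 * π)`. -/
noncomputable def reciprocalInverseGaussian (a l : ℝ) : ℝ := exp (-(l - a) ^ 2 / (2 * l)) / √l

/-- An antiderivative of `reciprocalInverseGaussian a` on `(0, ∞)`. -/
noncomputable def reciprocalInverseGaussianPrimitive (a l : ℝ) : ℝ :=
  (∫ t in (0 : ℝ)..(√l - a / √l), exp (-(1 / 2) * t ^ 2)) +
    exp (2 * a) * ∫ t in (0 : ℝ)..(√l + a / √l), exp (-(1 / 2) * t ^ 2)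

theorem hasDerivAt_reciprocalInverseGaussianPrimitive (a : ℝ) {l : ℝ} (hl : 0 < l) :
    HasDerivAt (reciprocalInverseGaussianPrimitive a) (reciprocalInverseGaussian a l) l := by
  have hs : 0 < √l := sqrt_pos.2 hl
  have hsq : √l ^ 2 = l := sq_sqrt hl.le
  have hd : HasDerivAt (fun x => √x) (1 / (2 * √l)) l := hasDerivAt_sqrt hl.ne'
  have hdiv := (hasDerivAt_const l a).div hd hs.ne'
  have h := ((hasDerivAt_integral_exp_neg_half_sq _).comp l (hd.sub hdiv)).add
    (((hasDerivAt_integral_exp_neg_half_sq _).comp l (hd.add hdiv)).const_mul (exp (2 * a)))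
  refine h.congr_deriv ?_
  simp only [Pi.sub_apply, Pi.add_apply, Pi.div_apply]
  have e1 : -(1 / 2) * (√l - a / √l) ^ 2 = -(l - a) ^ 2 / (2 * l) := by
    rw [← hsq, sqrt_sq hs.le]; field_simp
  have e2 : exp (-(1 / 2) * (√l + a / √l) ^ 2) = exp (-(l - a) ^ 2 / (2 * l)) * exp (-(2 * a)) := by
    rw [← exp_add]
    congr 1
    rw [← hsq, sqrt_sq hs.le]; field_simp; ring
  have e3 : exp (2 * a) * exp (-(2 * a)) = 1 := by rw [← exp_add]; simp
  rw [e1, e2, reciprocalInverseGaussian]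
  generalize exp (-(l - a) ^ 2 / (2 * l)) = E
  have : ∀ D : ℝ, exp (2 * a) * (E * exp (-(2 * a)) * D) = E * D := fun D => by
    linear_combination E * D * e3
  rw [this]
  field_simp
  ring

theorem tendsto_reciprocalInverseGaussianPrimitive_atTop (a : ℝ) :
    Tendsto (reciprocalInverseGaussianPrimitive a) atTop
      (𝓝 (√(2 * π) / 2 + exp (2 * a) * (√(2 * π) / 2))) := by
  have hdiv : Tendsto (fun l => a / √l) atTop (𝓝 0) := tendsto_sqrt_atTop.const_div_atTop a
  refine (tendsto_integral_exp_neg_half_sq_atTop.comp ?_).add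
    ((tendsto_integral_exp_neg_half_sq_atTop.comp ?_).const_mul _)
  · simpa [sub_eq_add_neg] using tendsto_sqrt_atTop.atTop_add hdiv.neg
  · exact tendsto_sqrt_atTop.atTop_add hdiv

theorem tendsto_reciprocalInverseGaussianPrimitive_zero {a : ℝ} (ha : 0 < a) :
    Tendsto (reciprocalInverseGaussianPrimitive a) (𝓝[>] 0)
      (𝓝 (-(√(2 * π) / 2) + exp (2 * a) * (√(2 * π) / 2))) := by
  have hsqrt : Tendsto (fun l => √l) (𝓝[>] 0) (𝓝 0) := by
    simpa using (continuous_sqrt.tendsto 0).mono_left nhdsWithin_le_nhds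
  have hsqrt_pos : Tendsto (fun l => √l) (𝓝[>] 0) (𝓝[>] 0) :=
    tendsto_nhdsWithin_iff.2 ⟨hsqrt, eventually_mem_nhdsWithin.mono fun l hl => sqrt_pos.2 hl⟩
  have hdiv : Tendsto (fun l => a / √l) (𝓝[>] 0) atTop := by
    simpa only [div_eq_mul_inv, Function.comp_def] using
      (tendsto_inv_nhdsGT_zero.comp hsqrt_pos).const_mul_atTop ha
  refine (tendsto_integral_exp_neg_half_sq_atBot.comp ?_).add
    ((tendsto_integral_exp_neg_half_sq_atTop.comp ?_).const_mul _)
  · simpa only [sub_eq_add_neg, Function.comp_apply] using hsqrt.add_atBot (tendsto_neg_atTop_atBot.comp hdiv)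
  · exact hsqrt.add_atTop hdiv

theorem integrableOn_and_integral_reciprocalInverseGaussian {a : ℝ} (ha : 0 < a) :
    IntegrableOn (reciprocalInverseGaussian a) (Ioi 0) ∧
      ∫ l in Ioi (0 : ℝ), reciprocalInverseGaussian a l = √(2 * π) := by
  set b := -(√(2 * π) / 2) + exp (2 * a) * (√(2 * π) / 2) with hb
  set F := Function.update (reciprocalInverseGaussianPrimitive a) 0 b with hF
  have hcont : ContinuousWithinAt F (Ici 0) 0 := by
    rw [hF, continuousWithinAt_update_same, Ici_sdiff_left]
    exact tendsto_reciprocalInverseGaussianPrimitive_zero ha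
  have hderiv : ∀ l ∈ Ioi (0 : ℝ), HasDerivAt F (reciprocalInverseGaussian a l) l := fun l hl =>
    (hasDerivAt_reciprocalInverseGaussianPrimitive a hl).congr_of_eventuallyEq <| by
      filter_upwards [Ioi_mem_nhds hl] with x hx
      exact Function.update_of_ne (ne_of_gt hx) _ _
  have hpos : ∀ l ∈ Ioi (0 : ℝ), 0 ≤ reciprocalInverseGaussian a l := fun l _ => by
    unfold reciprocalInverseGaussian; positivity
  have htop := (tendsto_reciprocalInverseGaussianPrimitive_atTop a).congr' (f₂ := F) <| by
    filter_upwards [Ioi_mem_atTop 0] with x hx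
    exact (Function.update_of_ne (ne_of_gt hx) _ _).symm
  refine ⟨integrableOn_Ioi_deriv_of_nonneg hcont hderiv hpos htop, ?_⟩
  rw [integral_Ioi_of_hasDerivAt_of_nonneg hcont hderiv hpos htop, hF, Function.update_self, hb]
  ring

/-- Pointwise form of the Gibbs inequality: `x - y ≤ x log (x / y)`. -/
theorem sub_le_mul_log_sub_log {x y : ℝ} (hx : 0 ≤ x) (hy : 0 < y) :
    x - y ≤ x * (log x - log y) := by
  rcases hx.eq_or_lt with rfl | hx
  · simpa using hy.le
  have h := mul_le_mul_of_nonneg_left (log_le_sub_one_of_pos (div_pos hy hx)) hx.le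
  rw [log_div hy.ne' hx.ne', mul_sub, mul_sub, mul_div_cancel₀ _ hx.ne'] at h
  linarith

theorem log_reciprocalInverseGaussian_div (a : ℝ) {l : ℝ} (hl : 0 < l) :
    log (reciprocalInverseGaussian a l / √(2 * π)) =
      a - (1 / 2 * log (2 * π * l) + l / 2 + a ^ 2 / 2 * l⁻¹) := by
  have hs : 0 < √l := sqrt_pos.2 hl
  have hp : 0 < √(2 * π) := by positivity
  rw [reciprocalInverseGaussian, log_div (by positivity) hp.ne', log_div (exp_ne_zero _) hs.ne',
    log_exp, log_sqrt hl.le, log_sqrt (by positivity), log_mul (by positivity) hl.ne']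
  field_simp
  ring

/-- The Gibbs inequality against the reciprocal inverse Gaussian density. -/
theorem le_integral_entropy_add {q : ℝ → ℝ}
    (hq_nonneg : ∀ l ∈ Ioi (0 : ℝ), 0 ≤ q l)
    (hq_int : ∫ l in Ioi (0 : ℝ), q l = 1)
    (hJ : IntegrableOn (fun l => q l * l⁻¹) (Ioi 0))
    (hK : IntegrableOn (fun l => q l * (log (q l) + 1 / 2 * log (2 * π * l) + l / 2)) (Ioi 0))
    {a : ℝ} (ha : 0 ≤ a) :
    a ≤ (∫ l in Ioi (0 : ℝ), q l * (log (q l) + 1 / 2 * log (2 * π * l) + l / 2)) +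
      a ^ 2 / 2 * ∫ l in Ioi (0 : ℝ), q l * l⁻¹ := by
  have hq : IntegrableOn q (Ioi 0) := integrable_of_integral_eq_one hq_int
  have key : ∀ b : ℝ, 0 < b →
      b ≤ (∫ l in Ioi (0 : ℝ), q l * (log (q l) + 1 / 2 * log (2 * π * l) + l / 2)) +
        b ^ 2 / 2 * ∫ l in Ioi (0 : ℝ), q l * l⁻¹ := by
    intro b hb
    obtain ⟨hg, hg_int⟩ := integrableOn_and_integral_reciprocalInverseGaussian hb
    have hp : √(2 * π) ≠ 0 := by positivity
    have hsub : IntegrableOn (fun l => q l - reciprocalInverseGaussian b l / √(2 * π)) (Ioi 0) :=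
      hq.sub (hg.div_const _)
    have hmono : ∫ l in Ioi (0 : ℝ), (b * q l + (q l - reciprocalInverseGaussian b l / √(2 * π))) ≤
        ∫ l in Ioi (0 : ℝ), (q l * (log (q l) + 1 / 2 * log (2 * π * l) + l / 2) +
          b ^ 2 / 2 * (q l * l⁻¹)) := by
      refine setIntegral_mono_on ((hq.const_mul b).add hsub)
        (hK.add (hJ.const_mul _)) measurableSet_Ioi fun l hl => ?_
      have hl' : 0 < l := hl
      have hpos : 0 < reciprocalInverseGaussian b l / √(2 * π) := by
        unfold reciprocalInverseGaussian; positivity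
      have h := sub_le_mul_log_sub_log (hq_nonneg l hl) hpos
      rw [log_reciprocalInverseGaussian_div b hl'] at h
      linarith
    rw [integral_add (hq.const_mul b) hsub, integral_sub hq (hg.div_const _),
      integral_add hK (hJ.const_mul _), integral_const_mul, integral_const_mul, integral_div,
      hg_int, hq_int, div_self hp] at hmono
    linarith
  rcases ha.eq_or_lt with rfl | ha
  · refine le_of_tendsto_of_tendsto (b := 𝓝[>] (0 : ℝ)) (tendsto_id.mono_left nhdsWithin_le_nhds)
      (Tendsto.mono_left (Continuous.tendsto ?_ 0) nhdsWithin_le_nhds)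
      (eventually_mem_nhdsWithin.mono key)
    fun_prop
  · exact key a ha

theorem integral_sq_add_const_mul {Ω : Type*} [MeasurableSpace Ω] {μ : Measure Ω}
    [IsProbabilityMeasure μ] {Z : Ω → ℝ} (hZ : Integrable Z μ)
    (hZ2 : Integrable (fun ω => Z ω ^ 2) μ) (c l : ℝ) :
    ∫ ω, (l + c * Z ω) ^ 2 ∂μ = l ^ 2 + 2 * c * l * (∫ ω, Z ω ∂μ) + c ^ 2 * ∫ ω, Z ω ^ 2 ∂μ := by
  have h : ∀ ω, (l + c * Z ω) ^ 2 = l ^ 2 + 2 * c * l * Z ω + c ^ 2 * Z ω ^ 2 := fun ω => by ring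
  have hlin : Integrable (fun ω => l ^ 2 + 2 * c * l * Z ω) μ :=
    (integrable_const _).add (hZ.const_mul _)
  simp_rw [h]
  rw [integral_add hlin (hZ2.const_mul _),
    integral_add (integrable_const _) (hZ.const_mul _), integral_const_mul, integral_const_mul]
  simp

theorem integral_abs_le_sqrt_integral_sq {Ω : Type*} [MeasurableSpace Ω] {μ : Measure Ω}
    [IsProbabilityMeasure μ] {Z : Ω → ℝ} (hZ : Integrable Z μ)
    (hZ2 : Integrable (fun ω => Z ω ^ 2) μ) :
    ∫ ω, |Z ω| ∂μ ≤ √(∫ ω, Z ω ^ 2 ∂μ) := by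
  refine le_sqrt_of_sq_le ?_
  have h := integral_sq_add_const_mul hZ.abs (by simpa using hZ2) (1 : ℝ) (-∫ ω, |Z ω| ∂μ)
  have h0 : 0 ≤ ∫ ω, (-(∫ ω, |Z ω| ∂μ) + 1 * |Z ω|) ^ 2 ∂μ :=
    integral_nonneg fun _ => sq_nonneg _
  simp only [sq_abs] at h
  nlinarith

/-- Variational upper bound on the expected hinge loss under a corrupting
distribution, with the variational density `q` chosen independently of the
corruption: `2c·E[max(0,Z)] ≤ ∫ q(λ)[log q(λ) + ½ log(2πλ) + E[(λ+cZ)²]/(2λ)] dλ`. -/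
theorem expected_hinge_variational_bound {Ω : Type*} [MeasurableSpace Ω]
    (μ : Measure Ω) [IsProbabilityMeasure μ]
    (c : ℝ) (hc : 0 < c) (Z : Ω → ℝ) (hZ : Measurable Z)
    (hZ2 : Integrable (fun ω => (Z ω) ^ 2) μ)
    (q : ℝ → ℝ) (hq_meas : Measurable q)
    (hq_nonneg : ∀ l ∈ Set.Ioi (0 : ℝ), 0 ≤ q l)
    (hq_int : ∫ l in Set.Ioi (0 : ℝ), q l = 1)
    (h1 : IntegrableOn (fun l => q l * Real.log (q l)) (Set.Ioi 0))
    (h2 : IntegrableOn (fun l => q l * Real.log l) (Set.Ioi 0))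
    (h3 : IntegrableOn (fun l => l * q l) (Set.Ioi 0))
    (h4 : IntegrableOn (fun l => q l / l) (Set.Ioi 0)) :
    2 * c * ∫ ω, max 0 (Z ω) ∂μ ≤
      ∫ l in Set.Ioi (0 : ℝ),
        q l * (Real.log (q l) + (1 / 2) * Real.log (2 * π * l) +
          (∫ ω, (l + c * Z ω) ^ 2 ∂μ) / (2 * l)) := by
  have hZ1 : Integrable Z μ :=
    ((memLp_two_iff_integrable_sq hZ.aestronglyMeasurable).2 hZ2).integrable (by norm_num)
  have hq : IntegrableOn q (Ioi 0) := integrable_of_integral_eq_one hq_int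
  have hJ : IntegrableOn (fun l => q l * l⁻¹) (Ioi 0) := by simpa only [div_eq_mul_inv] using h4
  have hK : IntegrableOn (fun l => q l * (log (q l) + 1 / 2 * log (2 * π * l) + l / 2))
      (Ioi 0) := by
    have h : IntegrableOn (fun l => q l * log (q l) + 1 / 2 * log (2 * π) * q l +
        1 / 2 * (q l * log l) + 1 / 2 * (l * q l)) (Ioi 0) :=
      ((h1.add (hq.const_mul _)).add (h2.const_mul _)).add (h3.const_mul _)
    refine h.congr_fun (fun l hl => ?_) measurableSet_Ioi
    have hl' : 0 < l := hl
    simp only [log_mul (show 2 * π ≠ 0 by positivity) hl'.ne']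
    ring
  set m := ∫ ω, Z ω ∂μ with hm
  set s := ∫ ω, Z ω ^ 2 ∂μ with hs
  have hs0 : 0 ≤ s := integral_nonneg fun _ => sq_nonneg _
  have hrhs : ∫ l in Ioi (0 : ℝ), q l * (log (q l) + (1 / 2) * log (2 * π * l) +
        (∫ ω, (l + c * Z ω) ^ 2 ∂μ) / (2 * l)) =
      (∫ l in Ioi (0 : ℝ), q l * (log (q l) + 1 / 2 * log (2 * π * l) + l / 2)) + c * m +
        (c * √s) ^ 2 / 2 * ∫ l in Ioi (0 : ℝ), q l * l⁻¹ := by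
    have h : ∀ l ∈ Ioi (0 : ℝ), q l * (log (q l) + (1 / 2) * log (2 * π * l) +
        (∫ ω, (l + c * Z ω) ^ 2 ∂μ) / (2 * l)) =
        q l * (log (q l) + 1 / 2 * log (2 * π * l) + l / 2) + c * m * q l +
          (c * √s) ^ 2 / 2 * (q l * l⁻¹) := fun l hl => by
      have hl' : 0 < l := hl
      rw [integral_sq_add_const_mul hZ1 hZ2, mul_pow, sq_sqrt hs0]
      field_simp
      ring
    have hKm : IntegrableOn (fun l =>
        q l * (log (q l) + 1 / 2 * log (2 * π * l) + l / 2) + c * m * q l) (Ioi 0) :=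
      hK.add (hq.const_mul _)
    rw [setIntegral_congr_fun measurableSet_Ioi h,
      integral_add hKm (hJ.const_mul _), integral_add hK (hq.const_mul _),
      integral_const_mul, integral_const_mul, hq_int, mul_one]
  have hlhs : 2 * c * ∫ ω, max 0 (Z ω) ∂μ = c * m + c * ∫ ω, |Z ω| ∂μ := by
    rw [hm, ← mul_add, ← integral_add hZ1 hZ1.abs, ← integral_const_mul, ← integral_const_mul]
    refine integral_congr_ae (ae_of_all _ fun ω => ?_)
    simp only [max_def]
    split_ifs with h
    · rw [abs_of_nonneg h]; ring
    · rw [abs_of_neg (not_le.1 h)]; ring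
  have hbound := le_integral_entropy_add hq_nonneg hq_int hJ hK
    (a := c * √s) (by positivity)
  have habs := mul_le_mul_of_nonneg_left (integral_abs_le_sqrt_integral_sq hZ1 hZ2) hc.le
  rw [hlhs, hrhs]
  linarith
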